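/- Let ν be a probability measure on (Ω,F) and g ∈ L¹(ν). The following are equivalent: (i) there exists a function L : [0,∞) → [0,∞] that is not identically 0 such that D_φ(μ‖ν) ≥ L(|∫ g dμ − ∫ g dν|) for every probability measure μ ≪ ν with g ∈ L¹(μ); (ii) there exists δ > 0 such that Λ_{g,ν}(t) < ∞ for every t with |t| < δ. -/

import Mathlib

open MeasureTheory Filter Set
open scoped ENNReal NNReal Topology

/-- Map an extended real to `ℝ≥0∞`, sending `⊤` to `⊤` and negative values to `0`. -/
noncomputable def erealToENNReal (x : EReal) : ℝ≥0∞ :=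
  if x = ⊤ then ⊤ else ENNReal.ofReal x.toReal

/-- `ψ*(y) = sup_{x ∈ ℝ} (x·y − φ(x+1))`, the convex conjugate of `ψ(x) := φ(x+1)`.
Since `φ 1 = 0`, the supremum is nonnegative (take `x = 0`), so we record it in `ℝ≥0∞`. -/
noncomputable def psiStar (φ : ℝ → ℝ≥0∞) (y : ℝ) : ℝ≥0∞ :=
  erealToENNReal (⨆ x : ℝ, ((x * y : ℝ) : EReal) - ((φ (x + 1) : ℝ≥0∞) : EReal))

/-- The `(φ,ν)`-cumulant generating function `Λ_{g,ν}(t) = inf_{λ ∈ ℝ} ∫ ψ*(t·g + λ) dν`. -/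
noncomputable def cgf {Ω : Type*} [MeasurableSpace Ω] (φ : ℝ → ℝ≥0∞)
    (ν : Measure Ω) (g : Ω → ℝ) (t : ℝ) : ℝ≥0∞ :=
  ⨅ lam : ℝ, ∫⁻ ω, psiStar φ (t * g ω + lam) ∂ν

/-- The φ-divergence `D_φ(μ‖ν) = ∫ φ(dμ/dν) dν` for `μ ≪ ν`. -/
noncomputable def divAC {Ω : Type*} [MeasurableSpace Ω] (φ : ℝ → ℝ≥0∞)
    (μ ν : Measure Ω) : ℝ≥0∞ :=
  ∫⁻ ω, φ ((μ.rnDeriv ν ω).toReal) ∂ν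


lemma erealToENNReal_eq (x : EReal) : erealToENNReal x = x.toENNReal := rfl

lemma psiStar_le (φ : ℝ → ℝ≥0∞) (y : ℝ) (c : ℝ≥0∞)
    (h : ∀ x : ℝ, φ (x + 1) ≠ ⊤ → ENNReal.ofReal (x * y - (φ (x + 1)).toReal) ≤ c) :
    psiStar φ y ≤ c := by
  unfold psiStar
  rw [erealToENNReal_eq]
  have h2 : (⨆ x : ℝ, ((x * y : ℝ) : EReal) - ((φ (x + 1) : ℝ≥0∞) : EReal)) ≤ (c : EReal) := by
    refine iSup_le fun x => ?_
    by_cases hx : φ (x + 1) = ⊤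
    · rw [hx]; simp
    · have h3 : ((x * y : ℝ) : EReal) - ((φ (x + 1) : ℝ≥0∞) : EReal)
          = ((x * y - (φ (x + 1)).toReal : ℝ) : EReal) := by
        rw [← EReal.coe_ennreal_toReal hx, EReal.coe_sub]
      rw [h3]
      have h4 := h x hx
      have h5 : ((x * y - (φ (x + 1)).toReal : ℝ) : EReal)
          ≤ ((ENNReal.ofReal (x * y - (φ (x + 1)).toReal) : ℝ≥0∞) : EReal) := by
        rw [EReal.coe_ennreal_ofReal]
        exact_mod_cast le_max_left _ _
      exact h5.trans (by exact_mod_cast h4)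
  calc _ ≤ ((c : EReal)).toENNReal := EReal.toENNReal_le_toENNReal h2
    _ = c := EReal.toENNReal_coe

lemma young (φ : ℝ → ℝ≥0∞) (x y : ℝ) :
    ENNReal.ofReal (x * y) ≤ psiStar φ y + φ (x + 1) := by
  by_cases hx : φ (x + 1) = ⊤
  · rw [hx]; simp
  have h1 : ENNReal.ofReal (x * y - (φ (x + 1)).toReal) ≤ psiStar φ y := by
    unfold psiStar
    rw [erealToENNReal_eq]
    have h3 : ((x * y : ℝ) : EReal) - ((φ (x + 1) : ℝ≥0∞) : EReal)
          = ((x * y - (φ (x + 1)).toReal : ℝ) : EReal) := by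
        rw [← EReal.coe_ennreal_toReal hx, EReal.coe_sub]
    have h4 := EReal.toENNReal_le_toENNReal
      (le_iSup (fun x : ℝ => ((x * y : ℝ) : EReal) - ((φ (x + 1) : ℝ≥0∞) : EReal)) x)
    rw [h3, EReal.toENNReal_of_ne_top (EReal.coe_ne_top _), EReal.toReal_coe] at h4
    exact h4
  calc ENNReal.ofReal (x * y) = ENNReal.ofReal ((x * y - (φ (x + 1)).toReal) + (φ (x + 1)).toReal) := by
        congr 1; ring
    _ ≤ ENNReal.ofReal (x * y - (φ (x + 1)).toReal) + ENNReal.ofReal (φ (x + 1)).toReal :=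
        ENNReal.ofReal_add_le
    _ ≤ _ := by rw [ENNReal.ofReal_toReal hx]; gcongr

lemma conv_scale (φ : ℝ → ℝ≥0∞)
    (hconv : ∀ x y : ℝ, ∀ a b : ℝ≥0, a + b = 1 →
      φ ((a : ℝ) * x + (b : ℝ) * y) ≤ (a : ℝ≥0∞) * φ x + (b : ℝ≥0∞) * φ y)
    (hone : φ 1 = 0) (θ z : ℝ) (h0 : 0 ≤ θ) (h1 : θ ≤ 1) :
    φ (1 + θ * z) ≤ ENNReal.ofReal θ * φ (1 + z) := by
  have h2 : 0 ≤ 1 - θ := by linarith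
  have := hconv (1 + z) 1 θ.toNNReal (1 - θ).toNNReal
    (by rw [← Real.toNNReal_add h0 h2]; simp)
  rw [hone, mul_zero, add_zero, Real.coe_toNNReal _ h0, Real.coe_toNNReal _ h2] at this
  have e : θ * (1 + z) + (1 - θ) * 1 = 1 + θ * z := by ring
  rw [e] at this
  exact this

lemma conv_scale_real (φ : ℝ → ℝ≥0∞)
    (hconv : ∀ x y : ℝ, ∀ a b : ℝ≥0, a + b = 1 →
      φ ((a : ℝ) * x + (b : ℝ) * y) ≤ (a : ℝ≥0∞) * φ x + (b : ℝ≥0∞) * φ y)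
    (hone : φ 1 = 0) (θ z : ℝ) (h0 : 0 ≤ θ) (h1 : θ ≤ 1) (hz : φ (1 + z) ≠ ⊤) :
    φ (1 + θ * z) ≠ ⊤ ∧ (φ (1 + θ * z)).toReal ≤ θ * (φ (1 + z)).toReal := by
  have h := conv_scale φ hconv hone θ z h0 h1
  have hf : ENNReal.ofReal θ * φ (1 + z) ≠ ⊤ := ENNReal.mul_ne_top ENNReal.ofReal_ne_top hz
  refine ⟨ne_top_of_le_ne_top hf h, ?_⟩
  have := ENNReal.toReal_mono hf h
  rwa [ENNReal.toReal_mul, ENNReal.toReal_ofReal h0] at this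

lemma lower_one {Ω : Type*} [MeasurableSpace Ω] (φ : ℝ → ℝ≥0∞) (hm : Measurable φ)
    (ν : Measure Ω) [IsProbabilityMeasure ν] (g : Ω → ℝ) (hgint : Integrable g ν) (t : ℝ)
    (ht : cgf φ ν g t ≠ ⊤) :
    ∃ C : ℝ, 0 ≤ C ∧ ∀ μ : Measure Ω, IsProbabilityMeasure μ → μ ≪ ν → Integrable g μ →
      ENNReal.ofReal (t * (∫ ω, g ω ∂μ - ∫ ω, g ω ∂ν) - C) ≤ divAC φ μ ν := by
  have : ∃ l : ℝ, ∫⁻ ω, psiStar φ (t * g ω + l) ∂ν ≠ ⊤ := by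
    by_contra! h
    exact ht (by simp [cgf, h])
  obtain ⟨l, hl⟩ := this
  refine ⟨(∫⁻ ω, psiStar φ (t * g ω + l) ∂ν).toReal, ENNReal.toReal_nonneg, ?_⟩
  intro μ hμ hac hgμ
  set r : Ω → ℝ := fun ω => (μ.rnDeriv ν ω).toReal with hr
  have hri : Integrable r ν := Measure.integrable_toReal_rnDeriv
  have hrg : Integrable (fun ω => r ω * g ω) ν := by
    have := (integrable_rnDeriv_smul_iff hac (f := g)).2 hgμ
    simpa [smul_eq_mul] using this
  have hr1 : ∫ ω, r ω ∂ν = 1 := by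
    rw [hr, Measure.integral_toReal_rnDeriv hac]; simp
  have hrg1 : ∫ ω, r ω * g ω ∂ν = ∫ ω, g ω ∂μ := by
    have := integral_rnDeriv_smul hac (f := g)
    simpa [smul_eq_mul] using this
  set F : Ω → ℝ := fun ω => (r ω - 1) * (t * g ω + l) with hF
  have hFe : F = fun ω => (t * (r ω * g ω) - t * g ω) + (l * r ω - l) := by
    funext ω; simp only [hF]; ring
  have hFi : Integrable F ν := by
    rw [hFe]
    exact ((hrg.const_mul t).sub (hgint.const_mul t)).add ((hri.const_mul l).sub (integrable_const l))
  have hFint : ∫ ω, F ω ∂ν = t * (∫ ω, g ω ∂μ - ∫ ω, g ω ∂ν) := by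
    rw [hFe]
    have i1 : Integrable (fun ω => t * (r ω * g ω) - t * g ω) ν :=
      (hrg.const_mul t).sub (hgint.const_mul t)
    have i2 : Integrable (fun ω => l * r ω - l) ν := (hri.const_mul l).sub (integrable_const l)
    rw [integral_add i1 i2, integral_sub (hrg.const_mul t) (hgint.const_mul t),
      integral_sub (hri.const_mul l) (integrable_const l)]
    simp only [integral_const_mul, hr1, hrg1]
    simp; ring
  have hle : ENNReal.ofReal (∫ ω, F ω ∂ν) ≤ ∫⁻ ω, ENNReal.ofReal (F ω) ∂ν := by
    rw [integral_eq_lintegral_pos_part_sub_lintegral_neg_part hFi]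
    refine (ENNReal.ofReal_le_ofReal (sub_le_self _ ENNReal.toReal_nonneg)).trans ?_
    exact ENNReal.ofReal_toReal_le
  have hle2 : ∫⁻ ω, ENNReal.ofReal (F ω) ∂ν
      ≤ ∫⁻ ω, psiStar φ (t * g ω + l) ∂ν + divAC φ μ ν := by
    unfold divAC
    have hmm : Measurable fun ω => φ (μ.rnDeriv ν ω).toReal :=
      hm.comp (Measure.measurable_rnDeriv μ ν).ennreal_toReal
    rw [← lintegral_add_right _ hmm]
    refine lintegral_mono fun ω => ?_
    have := young φ (r ω - 1) (t * g ω + l)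
    simpa [hF, hr] using this
  rw [← hFint, ENNReal.ofReal_sub _ ENNReal.toReal_nonneg, ENNReal.ofReal_toReal hl]
  rw [tsub_le_iff_left]
  exact hle.trans hle2

/-- recursive selection of an almost optimal point among `q 0, …, q n` -/
noncomputable def selX (φ : ℝ → ℝ≥0∞) (q : ℕ → ℝ) : ℕ → ℝ → ℝ
  | 0, _ => 0
  | n + 1, y =>
    if selX φ q n y * y - (φ (1 + selX φ q n y)).toReal < q n * y - (φ (1 + q n)).toReal
    then q n else selX φ q n y

lemma selX_prop (φ : ℝ → ℝ≥0∞) (hm : Measurable φ) (hone : φ 1 = 0) (q : ℕ → ℝ)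
    (hq0 : ∀ n, 0 ≤ q n) (hqf : ∀ n, φ (1 + q n) ≠ ⊤) (n : ℕ) :
    Measurable (selX φ q n) ∧ (∀ y, 0 ≤ selX φ q n y) ∧ (∀ y, φ (1 + selX φ q n y) ≠ ⊤) ∧
    (∃ C : ℝ, ∀ y, selX φ q n y ≤ C ∧ (φ (1 + selX φ q n y)).toReal ≤ C) ∧
    (∀ y, y ≤ 0 → selX φ q n y = 0) ∧
    (∀ y, 0 ≤ selX φ q n y * y - (φ (1 + selX φ q n y)).toReal) := by
  induction n with
  | zero =>
    refine ⟨measurable_const, fun _ => le_rfl, fun y => by simp [selX, hone],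
      ⟨0, fun y => by simp [selX, hone]⟩, fun _ _ => rfl, fun y => by simp [selX, hone]⟩
  | succ n ih =>
    obtain ⟨h1, h2, h3, ⟨C, h4⟩, h5, h6⟩ := ih
    refine ⟨?_, ?_, ?_, ⟨max C (max (q n) (φ (1 + q n)).toReal), ?_⟩, ?_, ?_⟩
    · refine Measurable.ite ?_ measurable_const h1
      refine measurableSet_lt ?_ ?_
      · exact (h1.mul measurable_id).sub (hm.comp (measurable_const.add h1)).ennreal_toReal
      · exact (measurable_id.const_mul _).sub measurable_const
    · intro y; simp only [selX]; split_ifs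
      · exact hq0 n
      · exact h2 y
    · intro y; simp only [selX]; split_ifs
      · exact hqf n
      · exact h3 y
    · intro y; simp only [selX]; split_ifs
      · exact ⟨by simp, by simp⟩
      · exact ⟨(h4 y).1.trans (le_max_left _ _), (h4 y).2.trans (le_max_left _ _)⟩
    · intro y hy; simp only [selX]; split_ifs with h
      · exfalso
        have := h6 y
        have h7 : q n * y ≤ 0 := mul_nonpos_of_nonneg_of_nonpos (hq0 n) hy
        have h8 : 0 ≤ (φ (1 + q n)).toReal := ENNReal.toReal_nonneg
        linarith
      · exact h5 y hy
    · intro y; simp only [selX]; split_ifs with h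
      · exact (h6 y).trans h.le
      · exact h6 y

lemma selX_mono (φ : ℝ → ℝ≥0∞) (q : ℕ → ℝ) (y : ℝ) :
    Monotone fun n => selX φ q n y * y - (φ (1 + selX φ q n y)).toReal := by
  refine monotone_nat_of_le_succ fun n => ?_
  simp only [selX]; split_ifs with h
  · exact h.le
  · exact le_rfl

lemma selX_ge (φ : ℝ → ℝ≥0∞) (q : ℕ → ℝ) (y : ℝ) (n : ℕ) :
    q n * y - (φ (1 + q n)).toReal ≤
      selX φ q (n + 1) y * y - (φ (1 + selX φ q (n + 1) y)).toReal := by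
  simp only [selX]; split_ifs with h
  · exact le_rfl
  · exact not_lt.1 h

lemma exists_dense_seq' (φ : ℝ → ℝ≥0∞)
    (hconv : ∀ x y : ℝ, ∀ a b : ℝ≥0, a + b = 1 →
      φ ((a : ℝ) * x + (b : ℝ) * y) ≤ (a : ℝ≥0∞) * φ x + (b : ℝ≥0∞) * φ y)
    (hone : φ 1 = 0) :
    ∃ q : ℕ → ℝ, (∀ n, 0 ≤ q n) ∧ (∀ n, φ (1 + q n) ≠ ⊤) ∧
      ∀ y, 0 < y → ∀ x, φ (x + 1) ≠ ⊤ → ∀ c, c < x * y - (φ (x + 1)).toReal → 0 ≤ c →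
        ∃ n, c < q n * y - (φ (1 + q n)).toReal := by
  classical
  let e : ℕ → ℚ := fun n => (Denumerable.eqv ℚ).symm n
  refine ⟨fun n => if 0 ≤ (e n : ℝ) ∧ φ (1 + (e n : ℝ)) ≠ ⊤ then (e n : ℝ) else 0, ?_, ?_, ?_⟩
  · intro n; dsimp only; split_ifs with h
    · exact h.1
    · exact le_rfl
  · intro n; dsimp only; split_ifs with h
    · exact h.2
    · simp [hone]
  · intro y hy x hx c hc hc0
    have hp : 0 ≤ (φ (x + 1)).toReal := ENNReal.toReal_nonneg
    set v := x * y - (φ (x + 1)).toReal with hv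
    have hv0 : 0 < v := by linarith
    have hx0 : 0 < x := by
      have : 0 < x * y := by linarith
      exact (pos_iff_pos_of_mul_pos this).2 hy
    have hcv : c / v * x < x := by
      have : c / v < 1 := (div_lt_one hv0).2 hc
      nlinarith
    obtain ⟨r, hr1, hr2⟩ := exists_rat_btwn hcv
    have hcv0 : 0 ≤ c / v := div_nonneg hc0 hv0.le
    have hr0 : 0 < (r : ℝ) := lt_of_le_of_lt (mul_nonneg hcv0 hx0.le) hr1
    have hs := conv_scale_real φ hconv hone ((r : ℝ) / x) x (by positivity)
      ((div_le_one hx0).2 hr2.le) (by rwa [add_comm])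
    rw [div_mul_cancel₀ _ hx0.ne'] at hs
    refine ⟨(Denumerable.eqv ℚ) r, ?_⟩
    have her : e ((Denumerable.eqv ℚ) r) = r := by simp [e]
    simp only [her]
    rw [if_pos ⟨hr0.le, hs.1⟩]
    have h1 : c / v < r / x := by rwa [lt_div_iff₀ hx0]
    have h2 : c < r / x * v := by rwa [div_lt_iff₀ hv0] at h1
    have h3 : (r : ℝ) / x * v = r * y - r / x * (φ (1 + x)).toReal := by
      rw [hv, add_comm x 1]; field_simp
    linarith [hs.2]

lemma selection {Ω : Type*} [MeasurableSpace Ω] (φ : ℝ → ℝ≥0∞) (hm : Measurable φ)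
    (hconv : ∀ x y : ℝ, ∀ a b : ℝ≥0, a + b = 1 →
      φ ((a : ℝ) * x + (b : ℝ) * y) ≤ (a : ℝ≥0∞) * φ x + (b : ℝ≥0∞) * φ y)
    (hone : φ 1 = 0) (hneg : ∀ x : ℝ, x < 0 → φ x = ⊤)
    (ν : Measure Ω) [IsProbabilityMeasure ν] (Y : Ω → ℝ) (hY : Measurable Y)
    (hYi : Integrable Y ν) (htop : ∫⁻ ω, psiStar φ (Y ω) ∂ν = ⊤) (M : ℝ) :
    ∃ (u : Ω → ℝ) (C : ℝ), Measurable u ∧ (∀ ω, 0 ≤ u ω) ∧ (∀ ω, φ (1 + u ω) ≠ ⊤) ∧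
      (∀ ω, u ω ≤ C ∧ (φ (1 + u ω)).toReal ≤ C) ∧ (∀ ω, Y ω ≤ 0 → u ω = 0) ∧
      M ≤ ∫ ω, (u ω * Y ω - (φ (1 + u ω)).toReal) ∂ν := by
  obtain ⟨q, hq0, hqf, hqd⟩ := exists_dense_seq' φ hconv hone
  let E : ℕ → ℝ → ℝ := fun n y => selX φ q n y * y - (φ (1 + selX φ q n y)).toReal
  have hsp := selX_prop φ hm hone q hq0 hqf
  have hEm : ∀ n, Measurable (E n) := fun n =>
    ((hsp n).1.mul measurable_id).sub (hm.comp (measurable_const.add (hsp n).1)).ennreal_toReal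
  have hpt : ∀ ω, psiStar φ (Y ω) ≤ ENNReal.ofReal ‖Y ω‖ + ⨆ n, ENNReal.ofReal (E n (Y ω)) := by
    intro ω
    refine psiStar_le φ _ _ fun x hx => ?_
    have hp : 0 ≤ (φ (x + 1)).toReal := ENNReal.toReal_nonneg
    rcases le_or_gt (Y ω) 0 with hy | hy
    · refine le_add_right (ENNReal.ofReal_le_ofReal ?_)
      rw [Real.norm_eq_abs, abs_of_nonpos hy]
      have hx1 : 0 ≤ x + 1 := by
        by_contra! h
        exact hx (hneg _ h)
      nlinarith
    · refine le_add_left (le_of_forall_lt fun c hc => ?_)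
      have hc' : c ≠ ⊤ := ne_top_of_lt hc
      have hcr : c.toReal < x * Y ω - (φ (x + 1)).toReal := by
        rw [ENNReal.lt_ofReal_iff_toReal_lt hc'] at hc
        exact hc
      obtain ⟨n, hn⟩ := hqd (Y ω) hy x hx _ hcr ENNReal.toReal_nonneg
      refine lt_of_lt_of_le ?_ (le_iSup (fun n => ENNReal.ofReal (E n (Y ω))) (n + 1))
      rw [ENNReal.lt_ofReal_iff_toReal_lt hc']
      exact hn.trans_le (selX_ge φ q (Y ω) n)
  have hint : ⨆ n, ∫⁻ ω, ENNReal.ofReal (E n (Y ω)) ∂ν = ⊤ := by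
    have hEm' : ∀ n, Measurable fun ω => ENNReal.ofReal (E n (Y ω)) :=
      fun n => ((hEm n).comp hY).ennreal_ofReal
    rw [← lintegral_iSup hEm'
      (fun i j hij ω => ENNReal.ofReal_le_ofReal (selX_mono φ q (Y ω) hij))]
    have h1 := lintegral_mono (μ := ν) hpt
    rw [htop, lintegral_add_left hY.norm.ennreal_ofReal] at h1
    have h2 : ∫⁻ ω, ENNReal.ofReal ‖Y ω‖ ∂ν ≠ ⊤ := by
      rw [← ofReal_integral_eq_lintegral_ofReal hYi.norm (ae_of_all _ fun ω => norm_nonneg _)]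
      exact ENNReal.ofReal_ne_top
    have h3 := top_le_iff.1 h1
    rw [ENNReal.add_eq_top] at h3
    exact h3.resolve_left h2
  have : ∃ n, ENNReal.ofReal M < ∫⁻ ω, ENNReal.ofReal (E n (Y ω)) ∂ν := by
    rw [← lt_iSup_iff, hint]; exact ENNReal.ofReal_lt_top
  obtain ⟨n, hn⟩ := this
  obtain ⟨h1, h2, h3, ⟨C, h4⟩, h5, h6⟩ := hsp n
  refine ⟨fun ω => selX φ q n (Y ω), C, h1.comp hY, fun ω => h2 _, fun ω => h3 _, fun ω => h4 _,
    fun ω => h5 _, ?_⟩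
  have hi : Integrable (fun ω => E n (Y ω)) ν := by
    refine Integrable.sub ?_ ?_
    · refine hYi.bdd_mul (c := C) (h1.comp hY).aestronglyMeasurable (ae_of_all _ fun ω => ?_)
      simpa [Real.norm_eq_abs, abs_of_nonneg (h2 _)] using (h4 (Y ω)).1
    · refine Integrable.of_bound (C := C)
        (hm.comp (measurable_const.add (h1.comp hY))).ennreal_toReal.aestronglyMeasurable
        (ae_of_all _ fun ω => ?_)
      rw [Real.norm_eq_abs, abs_of_nonneg ENNReal.toReal_nonneg]
      exact (h4 (Y ω)).2
  rw [← ofReal_integral_eq_lintegral_ofReal hi (ae_of_all _ fun ω => h6 _)] at hn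
  exact (ENNReal.ofReal_lt_ofReal_iff'.1 hn).1.le

lemma construct {Ω : Type*} [MeasurableSpace Ω] (φ : ℝ → ℝ≥0∞) (hm : Measurable φ)
    (hconv : ∀ x y : ℝ, ∀ a b : ℝ≥0, a + b = 1 →
      φ ((a : ℝ) * x + (b : ℝ) * y) ≤ (a : ℝ≥0∞) * φ x + (b : ℝ≥0∞) * φ y)
    (hone : φ 1 = 0) (hneg : ∀ x : ℝ, x < 0 → φ x = ⊤)
    (hdom : (1 : ℝ) ∈ interior {x : ℝ | φ x ≠ ⊤})
    (ν : Measure Ω) [IsProbabilityMeasure ν] (g : Ω → ℝ) (hg : Measurable g)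
    (hgint : Integrable g ν) (x t : ℝ) (hx : 0 < x) (ht : 0 < t) (htop : cgf φ ν g t = ⊤) :
    ∃ μ : Measure Ω, IsProbabilityMeasure μ ∧ μ ≪ ν ∧ Integrable g μ ∧
      ∫ ω, g ω ∂μ - ∫ ω, g ω ∂ν = x ∧ divAC φ μ ν ≤ ENNReal.ofReal (t * x) := by
  classical
  -- the constant `c0`
  obtain ⟨c0, hc0, hφc0⟩ : ∃ c0 : ℝ, 0 < c0 ∧ φ (1 + -c0) ≠ ⊤ := by
    obtain ⟨ε, hε, hball⟩ := Metric.mem_nhds_iff.1 (mem_interior_iff_mem_nhds.1 hdom)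
    refine ⟨ε / 2, by positivity, ?_⟩
    have : (1 + -(ε / 2) : ℝ) ∈ Metric.ball (1 : ℝ) ε := by
      rw [Metric.mem_ball, Real.dist_eq, abs_lt]; constructor <;> linarith
    exact hball this
  have hc01 : 0 ≤ 1 + -c0 := by
    by_contra! h
    exact hφc0 (hneg _ h)
  -- the set `B`
  obtain ⟨b, hb0, hb⟩ : ∃ b : ℝ, 0 ≤ b ∧ ν {ω | |g ω| ≤ b} ≠ 0 := by
    by_contra! h
    have h1 : ν (⋃ n : ℕ, {ω | |g ω| ≤ n}) = 0 := measure_iUnion_null fun n => h n (by positivity)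
    have h2 : (⋃ n : ℕ, {ω | |g ω| ≤ n}) = univ := by
      ext ω; simpa using exists_nat_ge |g ω|
    rw [h2] at h1
    simp at h1
  set B : Set Ω := {ω | |g ω| ≤ b} with hB
  have hBm : MeasurableSet B := measurableSet_le hg.abs measurable_const
  set β : ℝ := ν.real B with hβ
  have hβ0 : 0 < β := ENNReal.toReal_pos hb (measure_ne_top _ _)
  set κ : ℝ := (φ (1 + -c0)).toReal / c0 with hκ
  have hκ0 : 0 ≤ κ := div_nonneg ENNReal.toReal_nonneg hc0.le
  set l : ℝ := t * b + κ + t * x / (β * c0) with hl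
  have hxx : 0 < t * x / (β * c0) := by positivity
  have hYtop : ∫⁻ ω, psiStar φ (t * g ω + -l) ∂ν = ⊤ := iInf_eq_top.1 htop (-l)
  have hYi : Integrable (fun ω => t * g ω + -l) ν := (hgint.const_mul t).add (integrable_const _)
  obtain ⟨u, C, hum, hu0, huf, huC, huz, hM⟩ := selection φ hm hconv hone hneg ν
    (fun ω => t * g ω + -l) ((hg.const_mul t).add measurable_const) hYi hYtop (t * x)
  have huB : ∀ ω ∈ B, u ω = 0 := by
    intro ω hω
    apply huz
    have : g ω ≤ b := (le_abs_self _).trans hω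
    have := mul_le_mul_of_nonneg_left this ht.le
    linarith
  set P : Ω → ℝ := fun ω => (φ (1 + u ω)).toReal with hP
  have hui : Integrable u ν := by
    refine Integrable.of_bound (C := C) hum.aestronglyMeasurable (ae_of_all _ fun ω => ?_)
    rw [Real.norm_eq_abs, abs_of_nonneg (hu0 ω)]; exact (huC ω).1
  have hPi : Integrable P ν := by
    refine Integrable.of_bound (C := C)
        (hm.comp (measurable_const.add hum)).ennreal_toReal.aestronglyMeasurable
        (ae_of_all _ fun ω => ?_)
    rw [Real.norm_eq_abs, abs_of_nonneg ENNReal.toReal_nonneg]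
    exact (huC ω).2
  have hP0 : ∀ ω, 0 ≤ P ω := fun ω => ENNReal.toReal_nonneg
  have hgui : Integrable (fun ω => u ω * g ω) ν := by
    refine hgint.bdd_mul (c := C) hum.aestronglyMeasurable (ae_of_all _ fun ω => ?_)
    rw [Real.norm_eq_abs, abs_of_nonneg (hu0 ω)]; exact (huC ω).1
  set m : ℝ := ∫ ω, u ω ∂ν with hmdef
  have hm0 : 0 ≤ m := integral_nonneg hu0
  set D1 : ℝ := ∫ ω, P ω ∂ν with hD1
  have hD10 : 0 ≤ D1 := integral_nonneg hP0
  set G : ℝ := ∫ ω, u ω * g ω ∂ν with hG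
  have hM' : t * x ≤ t * G - l * m - D1 := by
    have i1 : Integrable (fun ω => t * (u ω * g ω)) ν := hgui.const_mul t
    have i2 : Integrable (fun ω => l * u ω) ν := hui.const_mul l
    have i3 : Integrable (fun ω => t * (u ω * g ω) - l * u ω) ν := i1.sub i2
    have e : (fun ω => u ω * (t * g ω + -l) - (φ (1 + u ω)).toReal)
        = fun ω => (t * (u ω * g ω) - l * u ω) - P ω := by
      funext ω; simp only [hP]; ring
    rw [e, integral_sub i3 hPi, integral_sub i1 i2, integral_const_mul, integral_const_mul] at hM
    exact hM
  -- the indicator of `B`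
  set I : Ω → ℝ := B.indicator (fun _ => (1 : ℝ)) with hI
  have hIm : Measurable I := measurable_const.indicator hBm
  have hIi : Integrable I ν := (integrable_const 1).indicator hBm
  have hI1 : ∫ ω, I ω ∂ν = β := by
    rw [hI, integral_indicator_const _ hBm]; simp [hβ]
  have hIgi : Integrable (fun ω => I ω * g ω) ν := by
    refine hgint.bdd_mul (c := 1) hIm.aestronglyMeasurable (ae_of_all _ fun ω => ?_)
    by_cases h : ω ∈ B <;> simp [hI, h]
  set G2 : ℝ := ∫ ω, I ω * g ω ∂ν with hG2
  have hG2le : G2 ≤ b * β := by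
    have : G2 ≤ ∫ ω, b * I ω ∂ν := by
      refine integral_mono hIgi (hIi.const_mul b) fun ω => ?_
      by_cases h : ω ∈ B
      · simp only [hI, h, indicator_of_mem]
        have : g ω ≤ b := (le_abs_self _).trans h
        linarith
      · simp [hI, h]
    rwa [integral_const_mul, hI1] at this
  set T : ℝ := G - m / β * G2 with hT
  have hmb : m / β * G2 ≤ m * b := by
    have := mul_le_mul_of_nonneg_left hG2le (div_nonneg hm0 hβ0.le)
    have e : m / β * (b * β) = m * b := by field_simp
    linarith
  have hTge : t * x + D1 + m * κ + m * (t * x / (β * c0)) ≤ t * T := by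
    have h1 : t * (m / β * G2) ≤ t * (m * b) := mul_le_mul_of_nonneg_left hmb ht.le
    have h2 : l * m = t * (m * b) + m * κ + m * (t * x / (β * c0)) := by rw [hl]; ring
    have h3 : t * T = t * G - t * (m / β * G2) := by rw [hT]; ring
    linarith
  have hmk : 0 ≤ m * κ := mul_nonneg hm0 hκ0
  have hmx : 0 ≤ m * (t * x / (β * c0)) := mul_nonneg hm0 hxx.le
  have hxT : x ≤ T := by
    have : t * x ≤ t * T := by linarith
    exact le_of_mul_le_mul_left this ht
  have hT0 : 0 < T := hx.trans_le hxT
  set s : ℝ := x / T with hs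
  have hs0 : 0 < s := div_pos hx hT0
  have hs1 : s ≤ 1 := (div_le_one hT0).2 hxT
  have hsT : s * T = x := div_mul_cancel₀ _ hT0.ne'
  set θ : ℝ := s * (m / β) / c0 with hθ
  have hθ0 : 0 ≤ θ := by positivity
  have hθ1 : θ ≤ 1 := by
    have h1 : t * (m * (x / (β * c0))) ≤ t * T := by
      have : t * (m * (x / (β * c0))) = m * (t * x / (β * c0)) := by ring
      have := mul_pos ht hx
      linarith
    have h2 : m * (x / (β * c0)) ≤ T := le_of_mul_le_mul_left h1 ht
    have h3 : θ = m * (x / (β * c0)) / T := by rw [hθ, hs]; field_simp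
    rw [h3]; exact (div_le_one hT0).2 h2
  have hθc : θ * c0 = s * (m / β) := div_mul_cancel₀ _ hc0.ne'
  -- the density
  set h : Ω → ℝ := fun ω => 1 + s * (u ω - m / β * I ω) with hh
  have hhB : ∀ ω ∈ B, h ω = 1 + θ * -c0 := by
    intro ω hω
    simp only [hh, hI, indicator_of_mem hω, huB ω hω]
    linarith
  have hhB' : ∀ ω, ω ∉ B → h ω = 1 + s * u ω := by
    intro ω hω
    simp [hh, hI, hω]
  have hhm : Measurable h :=
    measurable_const.add ((hum.sub (hIm.const_mul _)).const_mul s)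
  have hh0 : ∀ ω, 0 ≤ h ω := by
    intro ω
    by_cases hω : ω ∈ B
    · rw [hhB ω hω]
      have : θ * c0 ≤ 1 * c0 := mul_le_mul_of_nonneg_right hθ1 hc0.le
      linarith
    · rw [hhB' ω hω]
      have := mul_nonneg hs0.le (hu0 ω)
      linarith
  have hki : Integrable (fun ω => u ω - m / β * I ω) ν := hui.sub (hIi.const_mul _)
  have hhi : Integrable h ν := (integrable_const 1).add (hki.const_mul s)
  have hh1 : ∫ ω, h ω ∂ν = 1 := by
    rw [hh, integral_add (integrable_const 1) (hki.const_mul s), integral_const_mul,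
      integral_sub hui (hIi.const_mul _), integral_const_mul, hI1, div_mul_cancel₀ _ hβ0.ne']
    simp [hmdef]
  have hhge : (fun ω => h ω * g ω) = fun ω => g ω + s * (u ω * g ω - m / β * (I ω * g ω)) := by
    funext ω; simp only [hh]; ring
  have hkgi : Integrable (fun ω => u ω * g ω - m / β * (I ω * g ω)) ν :=
    hgui.sub (hIgi.const_mul _)
  have hhgi : Integrable (fun ω => h ω * g ω) ν := by
    rw [hhge]; exact hgint.add (hkgi.const_mul s)
  have hhg1 : ∫ ω, h ω * g ω ∂ν = ∫ ω, g ω ∂ν + x := by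
    rw [hhge, integral_add hgint (hkgi.const_mul s), integral_const_mul,
      integral_sub hgui (hIgi.const_mul _), integral_const_mul, ← hsT]
  set f : Ω → ℝ≥0∞ := fun ω => ENNReal.ofReal (h ω) with hf
  have hfm : Measurable f := hhm.ennreal_ofReal
  have hflt : ∀ᵐ ω ∂ν, f ω < ⊤ := ae_of_all _ fun ω => ENNReal.ofReal_lt_top
  have hfr : ∀ ω, (f ω).toReal = h ω := fun ω => ENNReal.toReal_ofReal (hh0 ω)
  refine ⟨ν.withDensity f, ?_, withDensity_absolutelyContinuous _ _, ?_, ?_, ?_⟩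
  · constructor
    rw [withDensity_apply _ MeasurableSet.univ, Measure.restrict_univ,
      ← ofReal_integral_eq_lintegral_ofReal hhi (ae_of_all _ hh0), hh1]
    simp
  · rw [integrable_withDensity_iff_integrable_smul' hfm hflt]
    simpa only [hfr, smul_eq_mul] using hhgi
  · rw [integral_withDensity_eq_integral_toReal_smul hfm hflt]
    simp only [hfr, smul_eq_mul]
    rw [hhg1]; ring
  · unfold divAC
    have hae : (fun ω => φ ((ν.withDensity f).rnDeriv ν ω).toReal) =ᵐ[ν] fun ω => φ (h ω) := by
      filter_upwards [Measure.rnDeriv_withDensity ν hfm] with ω hω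
      rw [hω, hfr]
    rw [lintegral_congr_ae hae]
    set R : Ω → ℝ := fun ω => s * (P ω + m / β * κ * I ω) with hR
    have hI0 : ∀ ω, 0 ≤ I ω := fun ω => indicator_nonneg (fun _ _ => zero_le_one) ω
    have hR0 : ∀ ω, 0 ≤ R ω := fun ω => mul_nonneg hs0.le (add_nonneg (hP0 ω)
      (mul_nonneg (mul_nonneg (div_nonneg hm0 hβ0.le) hκ0) (hI0 ω)))
    have hRi : Integrable R ν := (hPi.add (hIi.const_mul _)).const_mul s
    have hle : ∀ ω, φ (h ω) ≤ ENNReal.ofReal (R ω) := by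
      intro ω
      by_cases hω : ω ∈ B
      · rw [hhB ω hω]
        refine (conv_scale φ hconv hone θ (-c0) hθ0 hθ1).trans ?_
        rw [← ENNReal.ofReal_toReal hφc0, ← ENNReal.ofReal_mul hθ0]
        refine ENNReal.ofReal_le_ofReal (le_of_eq ?_)
        simp only [hR, hP, huB ω hω, hI, indicator_of_mem hω, hκ, hθ]
        simp only [add_zero, hone, ENNReal.toReal_zero]
        field_simp
        ring
      · rw [hhB' ω hω]
        refine (conv_scale φ hconv hone s (u ω) hs0.le hs1).trans ?_
        rw [← ENNReal.ofReal_toReal (huf ω), ← ENNReal.ofReal_mul hs0.le]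
        refine ENNReal.ofReal_le_ofReal (le_of_eq ?_)
        simp [hR, hP, hI, hω]
    refine (lintegral_mono hle).trans ?_
    rw [← ofReal_integral_eq_lintegral_ofReal hRi (ae_of_all _ hR0)]
    refine ENNReal.ofReal_le_ofReal ?_
    have hRe : ∫ ω, R ω ∂ν = s * (D1 + m * κ) := by
      rw [hR, integral_const_mul, integral_add hPi (hIi.const_mul _), integral_const_mul, hI1]
      have : m / β * κ * β = m * κ := by field_simp
      rw [this]
    rw [hRe]
    have h1 : s * (D1 + m * κ) ≤ s * (t * T) := by
      refine mul_le_mul_of_nonneg_left ?_ hs0.le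
      have := mul_pos ht hx
      linarith
    have h2 : s * (t * T) = t * x := by rw [← hsT]; ring
    linarith

/-- **Existence of a nontrivial lower bound of the φ-divergence by the absolute mean
deviation of `g` is equivalent to finiteness of `Λ_{g,ν}` on a neighborhood of `0`.**
Let `ν` be a probability measure and `g ∈ L¹(ν)`.  There exists a not-identically-zero
`L : [0,∞) → [0,∞]` with `D_φ(μ‖ν) ≥ L(|∫ g dμ − ∫ g dν|)` for every probability measure
`μ ≪ ν` integrating `g`, if and only if there exists `δ > 0` with `Λ_{g,ν}(t) < ∞` for
all `|t| < δ`. -/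
theorem nontrivial_lower_bound_iff_cgf_finite {Ω : Type*} [MeasurableSpace Ω]
    (φ : ℝ → ℝ≥0∞)
    (hconv : ∀ x y : ℝ, ∀ a b : ℝ≥0, a + b = 1 →
      φ ((a : ℝ) * x + (b : ℝ) * y) ≤ (a : ℝ≥0∞) * φ x + (b : ℝ≥0∞) * φ y)
    (hlsc : LowerSemicontinuous φ)
    (hneg : ∀ x : ℝ, x < 0 → φ x = ⊤)
    (hone : φ 1 = 0)
    (hdom : (1 : ℝ) ∈ interior {x : ℝ | φ x ≠ ⊤})
    (ν : Measure Ω) [IsProbabilityMeasure ν]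
    (g : Ω → ℝ) (hg : Measurable g) (hgint : Integrable g ν) :
    (∃ L : ℝ → ℝ≥0∞, (∃ x : ℝ, 0 ≤ x ∧ L x ≠ 0) ∧
        ∀ μ : Measure Ω, IsProbabilityMeasure μ → μ ≪ ν → Integrable g μ →
          L |∫ ω, g ω ∂μ - ∫ ω, g ω ∂ν| ≤ divAC φ μ ν)
    ↔ (∃ δ : ℝ, 0 < δ ∧ ∀ t : ℝ, |t| < δ → cgf φ ν g t ≠ ⊤) := by
  have hm : Measurable φ := hlsc.measurable
  constructor
  · rintro ⟨L, ⟨x, hx0, hLx⟩, hL⟩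
    by_contra! hcon
    have hdiv : divAC φ ν ν = 0 := by
      unfold divAC
      have hae : (fun ω => φ (ν.rnDeriv ν ω).toReal) =ᵐ[ν] fun _ => 0 := by
        filter_upwards [Measure.rnDeriv_self ν] with ω hω
        simp [hω, hone]
      rw [lintegral_congr_ae hae]; simp
    have hL0 : L 0 = 0 := by
      have := hL ν inferInstance Measure.AbsolutelyContinuous.rfl hgint
      rw [hdiv] at this
      simpa using this
    have hx : 0 < x := by
      rcases hx0.eq_or_lt with h | h
      · rw [← h] at hLx; exact absurd hL0 hLx
      · exact h
    have hc0 : cgf φ ν g 0 ≠ ⊤ := by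
      have h1 : psiStar φ 0 = 0 := by
        refine le_antisymm (psiStar_le φ 0 0 fun z _ => ?_) bot_le
        simp
      have h2 : cgf φ ν g 0 ≤ ∫⁻ ω, psiStar φ (0 * g ω + 0) ∂ν := iInf_le _ 0
      simp [h1] at h2
      simp [h2]
    apply hLx
    refine le_antisymm (ENNReal.le_of_forall_pos_le_add fun ε hε _ => ?_) bot_le
    rw [zero_add]
    have hε' : (0 : ℝ) < ε := hε
    obtain ⟨t, ht, htop⟩ := hcon (ε / x) (by positivity)
    have ht0 : t ≠ 0 := by rintro rfl; exact hc0 htop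
    have htx : |t| * x ≤ ε := by
      rw [lt_div_iff₀ hx] at ht; exact ht.le
    have hfin : ENNReal.ofReal (|t| * x) ≤ ε :=
      (ENNReal.ofReal_le_ofReal htx).trans (by simp)
    rcases lt_or_gt_of_ne ht0 with hneg' | hpos
    · have htop' : cgf φ ν (fun ω => - g ω) (-t) = ⊤ := by
        rw [← htop]; simp [cgf]
      obtain ⟨μ, h1, h2, h3, h4, h5⟩ := construct φ hm hconv hone hneg hdom ν (fun ω => - g ω)
        hg.neg hgint.neg x (-t) hx (by linarith) htop'
      have h3' : Integrable g μ := by simpa using h3.neg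
      have h6 := hL μ h1 h2 h3'
      rw [integral_neg, integral_neg] at h4
      have h7 : |∫ ω, g ω ∂μ - ∫ ω, g ω ∂ν| = x := by
        rw [show ∫ ω, g ω ∂μ - ∫ ω, g ω ∂ν = -x by linarith, abs_neg, abs_of_pos hx]
      rw [h7] at h6
      rw [abs_of_neg hneg'] at hfin
      exact h6.trans (h5.trans hfin)
    · obtain ⟨μ, h1, h2, h3, h4, h5⟩ := construct φ hm hconv hone hneg hdom ν g
        hg hgint x t hx hpos htop
      have h6 := hL μ h1 h2 h3
      rw [h4, abs_of_pos hx] at h6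
      rw [abs_of_pos hpos] at hfin
      exact h6.trans (h5.trans hfin)
  · rintro ⟨δ, hδ, hfin⟩
    set t : ℝ := δ / 2 with ht
    have ht0 : 0 < t := by positivity
    have habs : |t| < δ := by rw [abs_of_pos ht0]; linarith
    obtain ⟨C1, hC1, h1⟩ := lower_one φ hm ν g hgint t (hfin t habs)
    obtain ⟨C2, hC2, h2⟩ := lower_one φ hm ν g hgint (-t) (hfin (-t) (by rwa [abs_neg]))
    refine ⟨fun x => ENNReal.ofReal (t * x - (C1 + C2)), ⟨(C1 + C2 + 1) / t, by positivity, ?_⟩, ?_⟩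
    · have : t * ((C1 + C2 + 1) / t) - (C1 + C2) = 1 := by field_simp; ring
      simp only [this]; simp
    · intro μ hμ hac hgμ
      rcases abs_cases (∫ ω, g ω ∂μ - ∫ ω, g ω ∂ν) with ⟨h, _⟩ | ⟨h, _⟩
      · refine le_trans (ENNReal.ofReal_le_ofReal ?_) (h1 μ hμ hac hgμ)
        rw [h]; linarith
      · refine le_trans (ENNReal.ofReal_le_ofReal ?_) (h2 μ hμ hac hgμ)
        rw [h]; linarith
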